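/- Let D ⊂ ℂ^n be a bounded domain and let f : D → D be a holomorphic self-map (not necessarily an automorphism) that extends holomorphically beyond the boundary: there exist an open set U containing the closure of D and a holomorphic map F : U → ℂ^n with F = f on D. If the fixed point set Fix(f) = {z ∈ D : f(z) = z} is discrete in D, then Fix(f) is a finite set. -/

import Mathlib

open Set Metric Filter Topology

noncomputable section

/-- `ℂ^n` with the Euclidean norm. -/
abbrev CSpace (n : ℕ) := EuclideanSpace ℂ (Fin n)

/-- `f` is an automorphism of the set `D`: a holomorphic bijection of `D` onto
itself with a holomorphic inverse. -/
def AutOn {n : ℕ} (D : Set (CSpace n)) (f : CSpace n → CSpace n) : Prop :=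
  DifferentiableOn ℂ f D ∧ Set.BijOn f D D ∧
  ∃ g : CSpace n → CSpace n, DifferentiableOn ℂ g D ∧ Set.BijOn g D D ∧
    (∀ z ∈ D, g (f z) = z) ∧ (∀ z ∈ D, f (g z) = z)

/-- The fixed point set of `f` in `D`. -/
def FixOn {n : ℕ} (D : Set (CSpace n)) (f : CSpace n → CSpace n) : Set (CSpace n) :=
  {z ∈ D | f z = z}

/-- Every point of `S` is isolated in `S`. -/
def DiscreteIn {n : ℕ} (S : Set (CSpace n)) : Prop :=
  ∀ z ∈ S, ∃ ε > 0, ∀ w ∈ S, w ≠ z → ε ≤ dist w z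

/-- `f` extends holomorphically beyond the boundary of `D`. -/
def ExtendsHolo {n : ℕ} (D : Set (CSpace n)) (f : CSpace n → CSpace n) : Prop :=
  ∃ U : Set (CSpace n), IsOpen U ∧ closure D ⊆ U ∧
    ∃ F : CSpace n → CSpace n, DifferentiableOn ℂ F U ∧ Set.EqOn F f D

/-- `H` is a compact subgroup of the automorphism group of `D`. -/
def IsCompactAutGroup {n : ℕ} (D : Set (CSpace n))
    (H : Set (CSpace n → CSpace n)) : Prop :=
  (∀ f ∈ H, AutOn D f) ∧
  (∃ e ∈ H, ∀ z ∈ D, e z = z) ∧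
  (∀ f ∈ H, ∀ g ∈ H, ∃ h ∈ H, ∀ z ∈ D, h z = f (g z)) ∧
  (∀ f ∈ H, ∃ g ∈ H, (∀ z ∈ D, g (f z) = z) ∧ (∀ z ∈ D, f (g z) = z)) ∧
  (∀ u : ℕ → (CSpace n → CSpace n), (∀ k, u k ∈ H) →
    ∃ φ : ℕ → ℕ, StrictMono φ ∧ ∃ f ∈ H, ∀ K : Set (CSpace n), K ⊆ D → IsCompact K →
      TendstoUniformlyOn (fun k => u (φ k)) f Filter.atTop K)

section

open MeasureTheory

theorem norm_fderiv_le_two_mul_div {E : Type*} [NormedAddCommGroup E] [NormedSpace ℂ E]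
    {f : E → ℂ} {x : E} {r M : ℝ} (hr : 0 < r)
    (hf : DifferentiableOn ℂ f (ball x r)) (hb : ∀ y ∈ ball x r, ‖f y‖ ≤ M) :
    ‖fderiv ℂ f x‖ ≤ 2 * M / r := by
  refine Complex.norm_fderiv_le_div_of_mapsTo_ball hf (fun y hy => ?_) hr
  have h1 := hb y hy
  have h2 := hb x (mem_ball_self hr)
  rw [mem_closedBall, dist_eq_norm]
  linarith [norm_sub_le (f y) (f x)]

theorem clm_apply_eq_sum {n : ℕ} {F : Type*} [NormedAddCommGroup F] [NormedSpace ℂ F]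
    (L : (Fin n → ℂ) →L[ℂ] F) (v : Fin n → ℂ) : L v = ∑ i, v i • L (Pi.single i 1) := by
  conv_lhs => rw [pi_eq_sum_univ' v, map_sum]
  simp only [map_smul]

theorem differentiableOn_intervalIntegral {n : ℕ} {U : Set (Fin n → ℂ)} (hU : IsOpen U)
    {a b : ℝ} {φ : (Fin n → ℂ) → ℝ → ℂ}
    (hc : ContinuousOn (Function.uncurry φ) (U ×ˢ uIcc a b))
    (hd : ∀ t ∈ uIcc a b, DifferentiableOn ℂ (fun x => φ x t) U) :
    DifferentiableOn ℂ (fun x => ∫ t in a..b, φ x t) U := by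
  intro x₀ hx₀
  obtain ⟨ε, hε, hεU⟩ := Metric.nhds_basis_closedBall.mem_iff.1 (hU.mem_nhds hx₀)
  have hcx : ∀ x ∈ U, ContinuousOn (φ x) (uIcc a b) := fun x hx =>
    hc.comp (f := fun t : ℝ => (x, t)) (by fun_prop) (fun t ht => ⟨hx, ht⟩)
  have hmeas : ∀ x ∈ U, AEStronglyMeasurable (φ x) (volume.restrict (uIoc a b)) := fun x hx =>
    ((hcx x hx).mono uIoc_subset_uIcc).aestronglyMeasurable measurableSet_uIoc
  have hdiff : ∀ t ∈ uIcc a b, ∀ x ∈ U, DifferentiableAt ℂ (fun x => φ x t) x := fun t ht x hx =>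
    (hd t ht).differentiableAt (hU.mem_nhds hx)
  obtain ⟨M, hM⟩ := ((isCompact_closedBall x₀ ε).prod isCompact_uIcc).exists_bound_of_continuousOn
    (hc.mono (prod_mono hεU subset_rfl))
  have hM0 : 0 ≤ M := (norm_nonneg _).trans
    (hM (x₀, a) ⟨mem_closedBall_self hε.le, left_mem_uIcc⟩)
  have hfd : ∀ t ∈ uIcc a b, ∀ x ∈ ball x₀ (ε / 2),
      ‖fderiv ℂ (fun x => φ x t) x‖ ≤ 2 * M / (ε / 2) := by
    intro t ht x hx
    have hsub : ball x (ε / 2) ⊆ closedBall x₀ ε := fun y hy => by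
      rw [mem_ball] at hx hy
      rw [mem_closedBall]
      linarith [dist_triangle y x x₀]
    exact norm_fderiv_le_two_mul_div (by positivity) ((hd t ht).mono (hsub.trans hεU))
      (fun y hy => hM (y, t) ⟨hsub hy, ht⟩)
  have hcoord : ∀ v : Fin n → ℂ, AEStronglyMeasurable
      (fun t => fderiv ℂ (fun x => φ x t) x₀ v) (volume.restrict (uIoc a b)) := by
    intro v
    have hnorm : Tendsto (fun k : ℕ => ‖(k : ℂ) + 1‖) atTop atTop := by
      have : (fun k : ℕ => ‖(k : ℂ) + 1‖) = fun k : ℕ => (k : ℝ) + 1 := by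
        funext k
        exact_mod_cast Complex.norm_natCast (k + 1)
      rw [this]
      exact tendsto_atTop_add_const_right _ _ tendsto_natCast_atTop_atTop
    have hlim : ∀ t ∈ uIcc a b, Tendsto (fun k : ℕ => ((k : ℂ) + 1) •
        (φ (x₀ + ((k : ℂ) + 1)⁻¹ • v) t - φ x₀ t)) atTop
        (𝓝 (fderiv ℂ (fun x => φ x t) x₀ v)) := by
      intro t ht
      refine ((hdiff t ht x₀ hx₀).hasFDerivAt.lim v (c := fun k : ℕ => (k : ℂ) + 1)
        (l := atTop) ?_)
      exact hnorm
    have hev : ∀ᶠ k : ℕ in atTop, x₀ + ((k : ℂ) + 1)⁻¹ • v ∈ U := by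
      have h1 : Tendsto (fun k : ℕ => x₀ + ((k : ℂ) + 1)⁻¹ • v) atTop (𝓝 (x₀ + (0 : ℂ) • v)) :=
        ((tendsto_inv₀_cobounded.comp (tendsto_norm_atTop_iff_cobounded.1 hnorm)).smul_const
          v).const_add x₀
      rw [zero_smul, add_zero] at h1
      exact h1 (hU.mem_nhds hx₀)
    obtain ⟨K, hK⟩ := eventually_atTop.1 hev
    refine aestronglyMeasurable_of_tendsto_ae atTop
      (f := fun k t => (((k + K : ℕ) : ℂ) + 1) •
        (φ (x₀ + (((k + K : ℕ) : ℂ) + 1)⁻¹ • v) t - φ x₀ t)) (fun k => ?_) ?_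
    · exact ((hmeas _ (hK _ (Nat.le_add_left K k))).sub (hmeas _ hx₀)).const_smul
        (((k + K : ℕ) : ℂ) + 1)
    · refine (ae_restrict_iff' measurableSet_uIoc).2 (ae_of_all _ fun t ht => ?_)
      exact (hlim t (uIoc_subset_uIcc ht)).comp (tendsto_add_atTop_nat K)
  have hF' : AEStronglyMeasurable (fun t => fderiv ℂ (fun x => φ x t) x₀)
      (volume.restrict (uIoc a b)) := by
    have : (fun t => fderiv ℂ (fun x => φ x t) x₀) = fun t => ∑ i,
        fderiv ℂ (fun x => φ x t) x₀ (Pi.single i 1) •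
          (ContinuousLinearMap.proj i : (Fin n → ℂ) →L[ℂ] ℂ) := by
      funext t
      ext v
      rw [clm_apply_eq_sum _ v]
      simp [mul_comm]
    rw [this]
    exact Finset.aestronglyMeasurable_fun_sum _ fun i _ => (hcoord _).smul_const _
  have key := (intervalIntegral.hasFDerivAt_integral_of_dominated_loc_of_lip
    (𝕜 := ℂ) (μ := volume) (a := a) (b := b) (F := φ)
    (F' := fun t => fderiv ℂ (fun x => φ x t) x₀) (x₀ := x₀)
    (bound := fun _ => 2 * M / (ε / 2)) (ball_mem_nhds x₀ (half_pos hε))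
    (eventually_of_mem (hU.mem_nhds hx₀) hmeas) (hcx x₀ hx₀).intervalIntegrable hF' ?_
    (by simp) ?_).2
  · exact key.differentiableAt.differentiableWithinAt
  · refine ae_of_all _ fun t ht => ?_
    refine (convex_ball x₀ (ε / 2)).lipschitzOnWith_of_nnnorm_fderiv_le (𝕜 := ℂ)
      (fun x hx => hdiff t (uIoc_subset_uIcc ht) x
        (hεU (ball_subset_closedBall (ball_subset_ball (by linarith) hx)))) (fun x hx => ?_)
    rw [← NNReal.coe_le_coe, coe_nnnorm, Real.coe_nnabs, abs_of_nonneg (by positivity)]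
    exact hfd t (uIoc_subset_uIcc ht) x hx
  · exact ae_of_all _ fun t ht => (hdiff t (uIoc_subset_uIcc ht) x₀ hx₀).hasFDerivAt

theorem differentiableOn_circleIntegral {n : ℕ} {U : Set (Fin n → ℂ)} (hU : IsOpen U)
    {c : ℂ} {r : ℝ} (hr : 0 ≤ r) {φ : (Fin n → ℂ) → ℂ → ℂ}
    (hc : ContinuousOn (Function.uncurry φ) (U ×ˢ sphere c r))
    (hd : ∀ w ∈ sphere c r, DifferentiableOn ℂ (fun x => φ x w) U) :
    DifferentiableOn ℂ (fun x => ∮ w in C(c, r), φ x w) U := by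
  refine differentiableOn_intervalIntegral hU ?_ fun t _ =>
    (hd _ (circleMap_mem_sphere c hr t)).fun_const_smul (deriv (circleMap c r) t)
  refine ContinuousOn.smul (f := fun p : (Fin n → ℂ) × ℝ => deriv (circleMap c r) p.2)
    (g := fun p : (Fin n → ℂ) × ℝ => φ p.1 (circleMap c r p.2)) ?_ ?_
  · simp only [deriv_circleMap]
    exact Continuous.continuousOn (by fun_prop)
  · exact hc.comp (f := fun p : (Fin n → ℂ) × ℝ => (p.1, circleMap c r p.2))
      (by fun_prop) fun p hp => ⟨hp.1, circleMap_mem_sphere c hr _⟩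

theorem differentiableOn_fderiv_apply {n : ℕ} {U : Set (Fin n → ℂ)} (hU : IsOpen U)
    {f : (Fin n → ℂ) → ℂ} (hf : DifferentiableOn ℂ f U) (v : Fin n → ℂ) :
    DifferentiableOn ℂ (fun x => fderiv ℂ f x v) U := by
  intro x₀ hx₀
  obtain ⟨ε, hε, hεU⟩ := Metric.isOpen_iff.1 hU x₀ hx₀
  set ρ : ℝ := ε / 2 / (‖v‖ + 1) with hρ
  have hv : 0 < ‖v‖ + 1 := by positivity
  have hρ0 : 0 < ρ := by positivity
  have hmem : ∀ x ∈ ball x₀ (ε / 2), ∀ w ∈ closedBall (0 : ℂ) ρ, x + w • v ∈ U := by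
    intro x hx w hw
    apply hεU
    rw [mem_ball, dist_eq_norm] at hx ⊢
    rw [mem_closedBall_zero_iff] at hw
    have h1 : ‖w • v‖ ≤ ε / 2 := by
      rw [norm_smul]
      calc ‖w‖ * ‖v‖ ≤ ρ * (‖v‖ + 1) := by gcongr; linarith
        _ = ε / 2 := by rw [hρ]; field_simp
    calc ‖x + w • v - x₀‖ = ‖(x - x₀) + w • v‖ := by congr 1; abel
      _ ≤ ‖x - x₀‖ + ‖w • v‖ := norm_add_le _ _
      _ < ε := by linarith
  have hline : ∀ x, Differentiable ℂ (fun w : ℂ => x + w • v) := fun x => by fun_prop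
  have heq : ∀ x ∈ ball x₀ (ε / 2), fderiv ℂ f x v =
      (2 * Real.pi * Complex.I : ℂ)⁻¹ • ∮ w in C(0, ρ), ((w - 0) ^ 2)⁻¹ • f (x + w • v) := by
    intro x hx
    have hd : DifferentiableOn ℂ (fun w : ℂ => f (x + w • v)) (closedBall 0 ρ) :=
      hf.comp (hline x).differentiableOn (hmem x hx)
    have h1 := Complex.two_pi_I_inv_smul_circleIntegral_sub_sq_inv_smul_of_differentiable
      (U := (fun w : ℂ => x + w • v) ⁻¹' U) (hU.preimage (hline x).continuous)
      (fun w hw => hmem x hx w hw) (f := fun w : ℂ => f (x + w • v))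
      (hf.comp (hline x).differentiableOn fun w hw => hw) (mem_ball_self hρ0)
    rw [h1]
    have h2 : HasFDerivAt f (fderiv ℂ f x) (x + (0 : ℂ) • v) := by
      rw [zero_smul, add_zero]
      refine (hf.differentiableAt (hU.mem_nhds ?_)).hasFDerivAt
      simpa using hmem x hx 0 (mem_closedBall_self hρ0.le)
    have h3 : HasDerivAt (fun w : ℂ => x + w • v) v 0 := by
      simpa using ((hasDerivAt_id (0 : ℂ)).smul_const v).const_add x
    exact (h2.comp_hasDerivAt (0 : ℂ) h3).deriv.symm
  refine DifferentiableAt.differentiableWithinAt ?_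
  refine DifferentiableOn.differentiableAt (s := ball x₀ (ε / 2)) ?_
    (ball_mem_nhds x₀ (half_pos hε))
  refine DifferentiableOn.congr ?_ heq
  refine (differentiableOn_circleIntegral isOpen_ball hρ0.le ?_ ?_).fun_const_smul
    ((2 * Real.pi * Complex.I : ℂ)⁻¹)
  · refine ContinuousOn.smul (f := fun p : (Fin n → ℂ) × ℂ => ((p.2 - 0) ^ 2)⁻¹)
      (g := fun p : (Fin n → ℂ) × ℂ => f (p.1 + p.2 • v)) ?_ ?_
    · refine ContinuousOn.inv₀ (by fun_prop) fun p hp => ?_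
      have := ne_of_mem_sphere hp.2 hρ0.ne'
      simpa using this
    · exact hf.continuousOn.comp (f := fun p : (Fin n → ℂ) × ℂ => p.1 + p.2 • v) (by fun_prop)
        fun p hp => hmem p.1 hp.1 p.2 (sphere_subset_closedBall hp.2)
  · intro w hw
    refine DifferentiableOn.fun_const_smul ?_ ((w - 0) ^ 2)⁻¹
    exact hf.comp (by fun_prop) fun x hx => hmem x hx w (sphere_subset_closedBall hw)

theorem exists_hadamard_factors {n : ℕ} {R : ℝ} {f : (Fin n → ℂ) → ℂ}
    (hf : DifferentiableOn ℂ f (ball 0 R)) {y : Fin n → ℂ} (hy : y ∈ ball 0 R) :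
    ∃ a : Fin n → (Fin n → ℂ) → ℂ, (∀ i, DifferentiableOn ℂ (a i) (ball 0 R)) ∧
      (∀ i, a i y = fderiv ℂ f y (Pi.single i 1)) ∧
      ∀ x ∈ ball 0 R, f x - f y = ∑ i, (x i - y i) * a i x := by
  have hmem : ∀ x ∈ ball (0 : Fin n → ℂ) R, ∀ t ∈ Icc (0 : ℝ) 1,
      y + (t : ℂ) • (x - y) ∈ ball (0 : Fin n → ℂ) R := by
    intro x hx t ht
    have := (convex_ball (0 : Fin n → ℂ) R).add_smul_sub_mem hy hx ht
    simpa only [Complex.coe_smul] using this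
  have hpd := fun v => differentiableOn_fderiv_apply isOpen_ball hf v
  have hcont : ∀ v, ContinuousOn (Function.uncurry fun (x : Fin n → ℂ) (t : ℝ) =>
      fderiv ℂ f (y + (t : ℂ) • (x - y)) v) (ball 0 R ×ˢ uIcc (0 : ℝ) 1) := fun v =>
    (hpd v).continuousOn.comp
      (f := fun p : (Fin n → ℂ) × ℝ => y + (p.2 : ℂ) • (p.1 - y)) (by fun_prop)
      fun p hp => hmem p.1 hp.1 p.2 (by simpa using hp.2)
  refine ⟨fun i x => ∫ t in (0 : ℝ)..1, fderiv ℂ f (y + (t : ℂ) • (x - y)) (Pi.single i 1),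
    fun i => ?_, fun i => by simp, fun x hx => ?_⟩
  · refine differentiableOn_intervalIntegral isOpen_ball (hcont _) fun t ht => ?_
    exact (hpd _).comp (by fun_prop) fun x hx => hmem x hx t (by simpa using ht)
  · have hcx : ∀ v, ContinuousOn (fun t : ℝ => fderiv ℂ f (y + (t : ℂ) • (x - y)) v)
        (uIcc (0 : ℝ) 1) := fun v =>
      (hcont v).comp (f := fun t : ℝ => (x, t)) (by fun_prop) fun t ht => ⟨hx, ht⟩
    have hderiv : ∀ t ∈ uIcc (0 : ℝ) 1, HasDerivAt (fun t : ℝ => f (y + (t : ℂ) • (x - y)))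
        (fderiv ℂ f (y + (t : ℂ) • (x - y)) (x - y)) t := by
      intro t ht
      have h1 : HasFDerivAt f (fderiv ℂ f (y + (t : ℂ) • (x - y))) (y + (t : ℂ) • (x - y)) :=
        (hf.differentiableAt (isOpen_ball.mem_nhds (hmem x hx t (by simpa using ht)))).hasFDerivAt
      have h2 : HasDerivAt (fun w : ℂ => y + w • (x - y)) (x - y) (t : ℂ) := by
        simpa using ((hasDerivAt_id (t : ℂ)).smul_const (x - y)).const_add y
      exact (h1.comp_hasDerivAt (t : ℂ) h2).comp_ofReal
    have h := intervalIntegral.integral_eq_sub_of_hasDerivAt hderiv (hcx _).intervalIntegrable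
    simp only [Complex.ofReal_one, one_smul, add_sub_cancel, Complex.ofReal_zero, zero_smul,
      add_zero] at h
    rw [← h]
    simp_rw [clm_apply_eq_sum _ (x - y), smul_eq_mul]
    rw [intervalIntegral.integral_finsetSum]
    · simp
    · exact fun i _ => ((hcx _).intervalIntegrable).const_mul _

theorem summable_prod_pow {n : ℕ} {x : Fin n → ℝ} (h0 : ∀ i, 0 ≤ x i) (h1 : ∀ i, x i < 1) :
    Summable fun α : Fin n → ℕ => ∏ i, x i ^ α i := by
  induction n with
  | zero => exact Summable.of_finite
  | succ n ih =>
    rw [← (Fin.consEquiv fun _ : Fin (n + 1) => ℕ).summable_iff]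
    have := (summable_geometric_of_lt_one (h0 0) (h1 0)).mul_of_nonneg
      (ih (x := fun i => x i.succ) (fun i => h0 _) fun i => h1 _)
      (fun k => pow_nonneg (h0 0) k)
      (fun α => Finset.prod_nonneg fun i _ => pow_nonneg (h0 _) _)
    refine this.congr fun p => ?_
    simp [Fin.consEquiv, Fin.prod_univ_succ]

theorem exists_powerSeries_coeff {n : ℕ} {R r M : ℝ} (hr : 0 < r) (hrR : r < R)
    {f : (Fin n → ℂ) → ℂ} (hf : DifferentiableOn ℂ f (ball 0 R))
    (hM : ∀ z ∈ closedBall 0 r, ‖f z‖ ≤ M) :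
    ∃ a : (Fin n → ℕ) → ℂ, (∀ α, ‖a α‖ ≤ M * ∏ i, r⁻¹ ^ α i) ∧
      ∀ z ∈ ball 0 r, HasSum (fun α => a α * ∏ i, z i ^ α i) (f z) := by
  induction n generalizing M with
  | zero =>
    refine ⟨fun _ => f 0, fun α => by simpa using hM 0 (mem_closedBall_self hr.le), fun z _ => ?_⟩
    rw [Subsingleton.elim z 0]
    simp [hasSum_unique]
  | succ n ih =>
    have hcons : Differentiable ℂ fun p : ℂ × (Fin n → ℂ) =>
        (Fin.cons p.1 p.2 : Fin (n + 1) → ℂ) := by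
      refine differentiable_pi.2 fun i => ?_
      refine Fin.cases ?_ (fun j => ?_) i
      · simp
      · simp only [Fin.cons_succ]
        fun_prop
    have hnorm : ∀ {ρ : ℝ} {w : ℂ} {z : Fin n → ℂ}, 0 < ρ → ‖w‖ < ρ → z ∈ ball 0 ρ →
        (Fin.cons w z : Fin (n + 1) → ℂ) ∈ ball 0 ρ := by
      intro ρ w z hρ hw hz
      rw [mem_ball_zero_iff, pi_norm_lt_iff hρ] at hz ⊢
      exact Fin.cases (by simp [hw]) (fun j => by simpa using hz j)
    have hnorm' : ∀ {w : ℂ} {z : Fin n → ℂ}, ‖w‖ ≤ r → z ∈ closedBall 0 r →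
        (Fin.cons w z : Fin (n + 1) → ℂ) ∈ closedBall 0 r := by
      intro w z hw hz
      rw [mem_closedBall_zero_iff, pi_norm_le_iff_of_nonneg hr.le] at hz ⊢
      exact Fin.cases (by simp [hw]) (fun j => by simpa using hz j)
    have hsph : ∀ {w : ℂ}, w ∈ sphere (0 : ℂ) r → ‖w‖ = r := fun hw => by simpa using hw
    let c : ℕ → (Fin n → ℂ) → ℂ := fun k z =>
      (2 * Real.pi * Complex.I : ℂ)⁻¹ • ∮ w in C(0, r), (1 / (w - 0)) ^ k •
        (w - 0)⁻¹ • f (Fin.cons w z)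
    have hcd : ∀ k, DifferentiableOn ℂ (c k) (ball 0 R) := by
      intro k
      refine (differentiableOn_circleIntegral isOpen_ball hr.le ?_ ?_).fun_const_smul
        ((2 * Real.pi * Complex.I : ℂ)⁻¹)
      · have hne : ∀ p ∈ ball (0 : Fin n → ℂ) R ×ˢ sphere (0 : ℂ) r, p.2 - 0 ≠ 0 := fun p hp => by
          simpa using ne_of_mem_sphere hp.2 hr.ne'
        refine ContinuousOn.smul (f := fun p : (Fin n → ℂ) × ℂ => (1 / (p.2 - 0)) ^ k) ?_
          (ContinuousOn.smul (f := fun p : (Fin n → ℂ) × ℂ => (p.2 - 0)⁻¹)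
          (g := fun p : (Fin n → ℂ) × ℂ => f (Fin.cons p.2 p.1)) ?_ ?_)
        · exact (continuousOn_const.div (by fun_prop) hne).pow k
        · exact ContinuousOn.inv₀ (by fun_prop) hne
        · exact hf.continuousOn.comp
            (f := fun p : (Fin n → ℂ) × ℂ => (Fin.cons p.2 p.1 : Fin (n + 1) → ℂ))
            (hcons.continuous.comp continuous_swap).continuousOn
            fun p hp => hnorm (hr.trans hrR) ((hsph hp.2).trans_lt hrR) hp.1
      · intro w hw
        refine DifferentiableOn.fun_const_smul (DifferentiableOn.fun_const_smul ?_ _) _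
        exact hf.comp (f := fun z => (Fin.cons w z : Fin (n + 1) → ℂ))
          (hcons.comp (f := fun z => (w, z)) (by fun_prop)).differentiableOn
          fun z hz => hnorm (hr.trans hrR) ((hsph hw).trans_lt hrR) hz
    have hcM : ∀ k, ∀ z ∈ closedBall (0 : Fin n → ℂ) r, ‖c k z‖ ≤ M * r⁻¹ ^ k := by
      intro k z hz
      have := circleIntegral.norm_two_pi_i_inv_smul_integral_le_of_norm_le_const (c := 0) (R := r)
        (f := fun w => (1 / (w - 0)) ^ k • (w - 0)⁻¹ • f (Fin.cons w z))
        (C := r⁻¹ ^ k * (r⁻¹ * M)) hr.le (fun w hw => ?_)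
      · refine this.trans_eq ?_
        field_simp
      · rw [norm_smul, norm_smul, norm_pow, norm_div, norm_inv, sub_zero, hsph hw, norm_one,
          one_div]
        gcongr
        exact hM _ (hnorm' (hsph hw).le hz)
    have hsum : ∀ w : ℂ, ∀ z : Fin n → ℂ, ‖w‖ < r → z ∈ ball 0 r →
        HasSum (fun k => c k z * w ^ k) (f (Fin.cons w z)) := by
      intro w z hw hz
      have hd : DifferentiableOn ℂ (fun w : ℂ => f (Fin.cons w z)) (closedBall 0 r) :=
        hf.comp (f := fun w : ℂ => (Fin.cons w z : Fin (n + 1) → ℂ))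
          (hcons.comp (f := fun w : ℂ => (w, z)) (by fun_prop)).differentiableOn fun w hw =>
          hnorm (hr.trans hrR) ((mem_closedBall_zero_iff.1 hw).trans_lt hrR)
            (ball_subset_ball hrR.le hz)
      obtain ⟨s, rfl⟩ : ∃ s : NNReal, (s : ℝ) = r := ⟨⟨r, hr.le⟩, rfl⟩
      have h1 := (hd.hasFPowerSeriesOnBall hr).hasSum (y := w) (by
        rw [Metric.eball_coe]
        simpa using hw)
      rw [zero_add] at h1
      refine h1.congr_fun fun k => ?_
      rw [FormalMultilinearSeries.apply_eq_pow_smul_coeff, smul_eq_mul, mul_comm]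
      congr 1
      exact (cauchyPowerSeries_apply _ _ _ _ _).symm
    choose a ha hasum using fun k => ih (hcd k) (hcM k)
    let e := Fin.consEquiv fun _ : Fin (n + 1) => ℕ
    refine ⟨fun α => a (α 0) (Fin.tail α), fun α => ?_, fun z hz => ?_⟩
    · refine (ha _ _).trans_eq ?_
      rw [Fin.prod_univ_succ, mul_assoc]
      rfl
    · have hz' : ∀ i, ‖z i‖ < r := by
        rwa [mem_ball_zero_iff, pi_norm_lt_iff hr] at hz
      have htail : Fin.tail z ∈ ball (0 : Fin n → ℂ) r := by
        rw [mem_ball_zero_iff, pi_norm_lt_iff hr]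
        exact fun i => hz' _
      have hs : Summable fun α : Fin (n + 1) → ℕ =>
          a (α 0) (Fin.tail α) * ∏ i, z i ^ α i := by
        refine Summable.of_norm_bounded (g := fun α => M * ∏ i, (r⁻¹ * ‖z i‖) ^ α i)
          ((summable_prod_pow (fun i => by positivity) fun i => ?_).mul_left M) fun α => ?_
        · rw [inv_mul_lt_iff₀ hr, mul_one]
          exact hz' i
        · rw [norm_mul, norm_prod]
          simp only [mul_pow, Finset.prod_mul_distrib, norm_pow, ← mul_assoc]
          gcongr
          refine (ha _ _).trans_eq ?_
          rw [Fin.prod_univ_succ, mul_assoc]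
          rfl
      have hsm := e.summable_iff.2 hs
      have h1 := hsm.hasSum.prod_fiberwise (g := fun k => c k (Fin.tail z) * z 0 ^ k) fun k => by
        refine ((hasum k (Fin.tail z) htail).mul_right (z 0 ^ k)).congr_fun fun α => ?_
        simp [e, Fin.consEquiv, Fin.prod_univ_succ, Fin.tail]
        ring
      have h2 := hsum (z 0) (Fin.tail z) (hz' 0) htail
      rw [Fin.cons_self_tail] at h2
      rw [h2.unique h1, ← e.hasSum_iff]
      exact hsm.hasSum

/-- The `i`-th prime. -/
abbrev primeAt (i : ℕ) : ℕ := Nat.nth Nat.Prime i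

theorem primeAt_prime (i : ℕ) : (primeAt i).Prime := Nat.prime_nth_prime i

/-- The natural number encoding a multi-index through its prime factorization. -/
def primeCode {n : ℕ} (α : Fin n → ℕ) : ℕ := ∏ i : Fin n, primeAt i ^ α i

theorem primeCode_pos {n : ℕ} (α : Fin n → ℕ) : 0 < primeCode α :=
  Finset.prod_pos fun i _ => pow_pos (primeAt_prime i).pos _

theorem primeCode_add {n : ℕ} (α β : Fin n → ℕ) :
    primeCode (α + β) = primeCode α * primeCode β := by
  simp [primeCode, pow_add, Finset.prod_mul_distrib]

theorem primeCode_injective {n : ℕ} : Function.Injective (primeCode (n := n)) := by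
  have key : ∀ (α : Fin n → ℕ) (i : Fin n), (primeCode α).factorization (primeAt i) = α i := by
    intro α i
    rw [primeCode, Nat.factorization_prod (g := fun j : Fin n => primeAt j ^ α j)
      fun j _ => (pow_pos (primeAt_prime j).pos _).ne', Finsupp.finsetSum_apply,
      Finset.sum_eq_single i]
    · simp
    · intro j _ hj
      have : primeAt j ≠ primeAt i := fun h =>
        hj (Fin.ext (Nat.nth_injective Nat.infinite_setOfPred_prime h))
      simp [this]
    · simp
  intro α β h
  funext i
  rw [← key α, ← key β, h]

/-- The weight of a multi-index. -/
def wt {n : ℕ} (t : ℕ) (α : Fin n → ℕ) : ℝ := ((primeCode α : ℝ) ^ t)⁻¹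

theorem primeCode_cast_pos {n : ℕ} (α : Fin n → ℕ) : (0 : ℝ) < primeCode α :=
  Nat.cast_pos.2 (primeCode_pos α)

theorem wt_pos {n : ℕ} (t : ℕ) (α : Fin n → ℕ) : 0 < wt t α :=
  inv_pos.2 (pow_pos (primeCode_cast_pos α) t)

theorem wt_add {n : ℕ} (t : ℕ) (α β : Fin n → ℕ) : wt t (α + β) = wt t α * wt t β := by
  simp [wt, primeCode_add, mul_pow, mul_comm]

theorem wt_sub_mul {n : ℕ} (t : ℕ) {s γ : Fin n → ℕ} (h : s ≤ γ) :
    wt t (γ - s) * wt t s = wt t γ := by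
  rw [← wt_add, tsub_add_cancel_of_le h]

theorem wt_anti {n : ℕ} {t u : ℕ} (h : t ≤ u) (α : Fin n → ℕ) : wt u α ≤ wt t α := by
  have := primeCode_pos α
  exact inv_anti₀ (pow_pos (primeCode_cast_pos α) t)
    (pow_le_pow_right₀ (Nat.one_le_cast.2 this) h)

theorem summable_wt_two {n : ℕ} : Summable (wt 2 : (Fin n → ℕ) → ℝ) :=
  (Real.summable_nat_pow_inv.2 one_lt_two).comp_injective primeCode_injective

/-- The monomial with exponent `α`. -/
def monom {n : ℕ} (z : Fin n → ℂ) (α : Fin n → ℕ) : ℂ := ∏ i, z i ^ α i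

theorem monom_add {n : ℕ} (z : Fin n → ℂ) (α β : Fin n → ℕ) :
    monom z (α + β) = monom z α * monom z β := by
  simp [monom, pow_add, Finset.prod_mul_distrib]

theorem differentiable_monom {n : ℕ} (α : Fin n → ℕ) :
    Differentiable ℂ fun z : Fin n → ℂ => monom z α := by
  unfold monom
  fun_prop

/-- Radius of a ball on which monomials are dominated by their weights. -/
def wtRadius (n t : ℕ) : ℝ := wt t (1 : Fin n → ℕ)

theorem wtRadius_pos (n t : ℕ) : 0 < wtRadius n t := wt_pos _ _

theorem norm_monom_le {n t : ℕ} {z : Fin n → ℂ} (hz : ‖z‖ ≤ wtRadius n t) (α : Fin n → ℕ) :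
    ‖monom z α‖ ≤ wt t α := by
  have h1 : ∀ i, ‖z i‖ ≤ ((primeAt i : ℝ) ^ t)⁻¹ := by
    intro i
    refine ((norm_le_pi_norm z i).trans hz).trans ?_
    refine inv_anti₀ (pow_pos (Nat.cast_pos.2 (primeAt_prime i).pos) t) ?_
    refine pow_le_pow_left₀ (Nat.cast_nonneg _) (Nat.cast_le.2 ?_) t
    simp only [primeCode, Pi.one_apply, pow_one]
    exact Finset.single_le_prod' (f := fun i : Fin n => primeAt i)
      (fun j _ => (primeAt_prime j).one_le) (Finset.mem_univ i)
  calc ‖monom z α‖ = ∏ i, ‖z i‖ ^ α i := by simp [monom]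
    _ ≤ ∏ i : Fin n, (((primeAt i : ℝ) ^ t)⁻¹) ^ α i := by
        gcongr with i
        exact h1 i
    _ = wt t α := by
        simp only [wt, primeCode, Nat.cast_prod, Nat.cast_pow, inv_pow, Finset.prod_inv_distrib,
          ← Finset.prod_pow, ← pow_mul, mul_comm]

/-- Weighted absolute summability of a coefficient family. -/
def WSummable {n : ℕ} (t : ℕ) (a : (Fin n → ℕ) → ℂ) : Prop :=
  Summable fun α => ‖a α‖ * wt t α

theorem WSummable.mono_wt {n t u : ℕ} {a : (Fin n → ℕ) → ℂ} (h : WSummable t a) (htu : t ≤ u) :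
    WSummable u a :=
  Summable.of_nonneg_of_le (fun _ => mul_nonneg (norm_nonneg _) (wt_pos _ _).le)
    (fun α => mul_le_mul_of_nonneg_left (wt_anti htu α) (norm_nonneg _)) h

theorem WSummable.summable {n t : ℕ} {a : (Fin n → ℕ) → ℂ} (h : WSummable t a)
    {z : Fin n → ℂ} (hz : ‖z‖ ≤ wtRadius n t) : Summable fun α => a α * monom z α :=
  Summable.of_norm_bounded h fun α => by
    rw [norm_mul]
    exact mul_le_mul_of_nonneg_left (norm_monom_le hz α) (norm_nonneg _)

/-- The sum of a power series. -/
def psum {n : ℕ} (a : (Fin n → ℕ) → ℂ) (z : Fin n → ℂ) : ℂ := ∑' α, a α * monom z α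

theorem WSummable.differentiableOn {n t : ℕ} {a : (Fin n → ℕ) → ℂ} (h : WSummable t a) :
    DifferentiableOn ℂ (psum a) (ball 0 (wtRadius n t / 2)) := by
  set ρ := wtRadius n t with hρ
  have hρ0 : 0 < ρ := wtRadius_pos n t
  have hd : ∀ α, Differentiable ℂ fun z : Fin n → ℂ => a α * monom z α := fun α =>
    (differentiable_monom α).const_mul _
  intro x hx
  refine (hasFDerivAt_tsum_of_isPreconnected (𝕜 := ℂ) (u := fun α => 4 / ρ * (‖a α‖ * wt t α))
    (h.mul_left _) isOpen_ball (convex_ball (0 : Fin n → ℂ) (ρ / 2)).isPreconnected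
    (f := fun α z => a α * monom z α) (f' := fun α z => fderiv ℂ (fun z => a α * monom z α) z)
    (fun α z _ => (hd α z).hasFDerivAt) (fun α z hz => ?_) (mem_ball_self (half_pos hρ0))
    (h.summable (by simpa using hρ0.le)) hx).differentiableAt.differentiableWithinAt
  refine (norm_fderiv_le_two_mul_div (M := ‖a α‖ * wt t α) (half_pos hρ0)
    (hd α).differentiableOn fun y hy => ?_).trans_eq (by ring)
  rw [norm_mul]
  refine mul_le_mul_of_nonneg_left (norm_monom_le ?_ α) (norm_nonneg _)
  rw [mem_ball_zero_iff] at hz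
  rw [mem_ball, dist_eq_norm] at hy
  linarith [norm_le_norm_add_norm_sub' y z]

theorem exists_wSummable_of_differentiableOn (n : ℕ) {R : ℝ} (hR : 0 < R) :
    ∃ t₀ : ℕ, ∀ h : (Fin n → ℂ) → ℂ, DifferentiableOn ℂ h (ball 0 R) →
      ∃ a, ∀ t ≥ t₀, WSummable t a ∧ ∀ z, ‖z‖ ≤ wtRadius n t → z ∈ ball 0 (R / 2) →
        h z = psum a z := by
  obtain ⟨t₁, ht₁⟩ : ∃ t₁ : ℕ, (1 / 2 : ℝ) ^ t₁ < R / 2 :=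
    exists_pow_lt_of_lt_one (half_pos hR) (by norm_num)
  refine ⟨t₁ + 2, fun h hh => ?_⟩
  obtain ⟨M, hM⟩ := (isCompact_closedBall (0 : Fin n → ℂ) (R / 2)).exists_bound_of_continuousOn
    (hh.continuousOn.mono (closedBall_subset_ball (half_lt_self hR)))
  have hM0 : 0 ≤ M := (norm_nonneg _).trans (hM 0 (mem_closedBall_self (half_pos hR).le))
  obtain ⟨a, ha, hsum⟩ := exists_powerSeries_coeff (half_pos hR) (half_lt_self hR) hh hM
  refine ⟨a, fun t ht => ⟨?_, fun z _ hz => ?_⟩⟩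
  · have : WSummable (t₁ + 2) a := by
      refine Summable.of_nonneg_of_le (fun _ => mul_nonneg (norm_nonneg _) (wt_pos _ _).le)
        (fun α => ?_) (summable_wt_two.mul_left M)
      have h1 : ∏ i, (R / 2)⁻¹ ^ α i ≤ (primeCode α : ℝ) ^ t₁ := by
        rw [primeCode, Nat.cast_prod, ← Finset.prod_pow]
        gcongr with i
        rw [Nat.cast_pow, ← pow_mul, mul_comm, pow_mul]
        gcongr
        have h2 : (R / 2)⁻¹ ≤ ((1 / 2 : ℝ) ^ t₁)⁻¹ := inv_anti₀ (by positivity) ht₁.le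
        refine h2.trans ?_
        rw [one_div, inv_pow, inv_inv]
        gcongr
        exact_mod_cast (primeAt_prime i).two_le
      calc ‖a α‖ * wt (t₁ + 2) α ≤ (M * (primeCode α : ℝ) ^ t₁) * wt (t₁ + 2) α := by
            gcongr
            · exact (wt_pos _ _).le
            · exact (ha α).trans (by gcongr)
        _ = M * wt 2 α := by
            have := (primeCode_cast_pos α).ne'
            rw [wt, wt]
            field_simp
            ring
    exact this.mono_wt ht
  · exact (hsum z hz).tsum_eq.symm

/-- A strictly triangular linear system whose kernel has weighted norm at most `1 / 2` is solvable
in the weighted `ℓ¹` space. -/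
theorem exists_summable_triangular_solution {ι : Type*} {N : ι → ℕ} (hN : Function.Injective N)
    {w : ι → ℝ} (hw : ∀ i, 0 ≤ w i) {K : ι → ι → ℂ} (hK0 : ∀ i j, ¬ N i < N j → K i j = 0)
    (hK : ∀ i, Summable fun j => ‖K i j‖ * w j) (hK2 : ∀ i, ∑' j, ‖K i j‖ * w j ≤ w i / 2)
    {h : ι → ℂ} (hh : Summable fun i => ‖h i‖ * w i) :
    ∃ b : ι → ℂ, (Summable fun i => ‖b i‖ * w i) ∧
      ∀ j, HasSum (fun i => K i j * b i) (h j - b j) := by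
  classical
  have hfin : ∀ m, {i | N i < m}.Finite := fun m => (finite_lt_nat m).preimage hN.injOn
  let F : ℕ → Finset ι := fun m => (hfin m).toFinset
  have hF : ∀ i m, i ∈ F m ↔ N i < m := fun i m => by simp [F]
  let b : ι → ℂ := (measure N).wf.fix fun j rec =>
    h j - ∑ i ∈ (F (N j)).attach, K i j * rec i ((hF _ _).1 i.2)
  have hb : ∀ j, b j = h j - ∑ i ∈ F (N j), K i j * b i := by
    intro j
    rw [← Finset.sum_attach]
    exact (measure N).wf.fix_eq _ j
  have hsum : ∀ j m, N j ≤ m → ∑ i ∈ F (N j), K i j * b i = ∑ i ∈ F m, K i j * b i := by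
    intro j m hm
    refine Finset.sum_subset (fun i hi => (hF _ _).2 (((hF _ _).1 hi).trans_le hm)) fun i _ hi => ?_
    rw [hK0 i j fun h => hi ((hF _ _).2 h), zero_mul]
  refine ⟨b, ?_, fun j => ?_⟩
  · have hbound : ∀ m, ∑ j ∈ F m, ‖b j‖ * w j ≤ 2 * ∑' j, ‖h j‖ * w j := by
      intro m
      have h1 : ∑ j ∈ F m, ‖b j‖ * w j ≤
          ∑ j ∈ F m, ‖h j‖ * w j + ∑ j ∈ F m, ∑ i ∈ F m, ‖b i‖ * (‖K i j‖ * w j) := by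
        rw [← Finset.sum_add_distrib]
        refine Finset.sum_le_sum fun j hj => ?_
        calc ‖b j‖ * w j ≤ (‖h j‖ + ∑ i ∈ F m, ‖K i j * b i‖) * w j := by
              refine mul_le_mul_of_nonneg_right ?_ (hw j)
              rw [hb j, hsum j m ((hF _ _).1 hj).le]
              exact (norm_sub_le _ _).trans (add_le_add_right (norm_sum_le _ _) _)
          _ = _ := by
              rw [add_mul, Finset.sum_mul]
              simp only [norm_mul]
              congr 1
              exact Finset.sum_congr rfl fun i _ => by ring
      have h2 : ∑ j ∈ F m, ∑ i ∈ F m, ‖b i‖ * (‖K i j‖ * w j) ≤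
          (∑ j ∈ F m, ‖b j‖ * w j) / 2 := by
        rw [Finset.sum_comm, Finset.sum_div]
        refine Finset.sum_le_sum fun i _ => ?_
        rw [← Finset.mul_sum, mul_div_assoc]
        refine mul_le_mul_of_nonneg_left (le_trans ?_ (hK2 i)) (norm_nonneg _)
        exact (hK i).sum_le_tsum _ fun j _ => mul_nonneg (norm_nonneg _) (hw j)
      have h3 : ∑ j ∈ F m, ‖h j‖ * w j ≤ ∑' j, ‖h j‖ * w j :=
        hh.sum_le_tsum _ fun j _ => mul_nonneg (norm_nonneg _) (hw j)
      linarith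
    refine summable_of_sum_le (c := 2 * ∑' j, ‖h j‖ * w j)
      (fun j => mul_nonneg (norm_nonneg _) (hw j)) fun u => ?_
    refine le_trans ?_ (hbound (u.sup N + 1))
    refine Finset.sum_le_sum_of_subset_of_nonneg (fun j hj => ?_)
      fun j _ _ => mul_nonneg (norm_nonneg _) (hw j)
    exact (hF _ _).2 (Nat.lt_succ_of_le (Finset.le_sup hj))
  · rw [hb j, sub_sub_cancel]
    refine hasSum_sum_of_ne_finset_zero fun i hi => ?_
    rw [hK0 i j fun h => hi ((hF _ _).2 h), zero_mul]

/-- The coefficients of a power series multiplied by the monomial with exponent `κ`. -/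
def shiftCoeff {n : ℕ} (κ : Fin n → ℕ) (a : (Fin n → ℕ) → ℂ) (β : Fin n → ℕ) : ℂ :=
  open Classical in if κ ≤ β then a (β - κ) else 0

theorem hasSum_shiftCoeff_iff {n : ℕ} {E : Type*} [AddCommMonoid E] [TopologicalSpace E]
    {κ : Fin n → ℕ} {a : (Fin n → ℕ) → ℂ} {g : (Fin n → ℕ) → ℂ → E} (hg : ∀ β, g β 0 = 0) {S : E} :
    HasSum (fun β => g β (shiftCoeff κ a β)) S ↔ HasSum (fun δ => g (δ + κ) (a δ)) S := by
  have hinj : Function.Injective fun δ : Fin n → ℕ => δ + κ := add_left_injective κ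
  rw [← hinj.hasSum_iff]
  · simp [Function.comp_def, shiftCoeff]
  · intro β hβ
    rw [shiftCoeff, if_neg, hg]
    exact fun h => hβ ⟨β - κ, tsub_add_cancel_of_le h⟩

theorem exists_division {n t : ℕ} {σ : (Fin n → ℕ) → Fin n → ℕ} (hσ : ∀ γ, σ γ ≤ γ)
    {A : (Fin n → ℕ) → (Fin n → ℕ) → ℂ} (hA1 : ∀ γ, A γ (σ γ) = 1)
    (hA0 : ∀ γ δ, primeCode δ < primeCode (σ γ) → A γ δ = 0) (hA : ∀ γ, WSummable t (A γ))
    (hA2 : ∀ γ, ∑' δ, ‖A γ δ‖ * wt t δ ≤ 3 / 2 * wt t (σ γ))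
    {h : (Fin n → ℕ) → ℂ} (hh : WSummable t h) :
    ∃ b, WSummable t b ∧ ∀ z : Fin n → ℂ, ‖z‖ ≤ wtRadius n t →
      HasSum (fun γ => b γ * (monom z (γ - σ γ) * psum (A γ) z)) (psum h z) := by
  classical
  let e : (Fin n → ℕ) → (Fin n → ℕ) → ℂ := fun γ => shiftCoeff (γ - σ γ) (A γ)
  have hadd : ∀ γ, σ γ + (γ - σ γ) = γ := fun γ => add_tsub_cancel_of_le (hσ γ)
  have he1 : ∀ γ, e γ γ = 1 := by
    intro γ
    have h1 : γ - σ γ ≤ γ := tsub_le_self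
    simp only [e, shiftCoeff, if_pos h1]
    rw [tsub_tsub_cancel_of_le (hσ γ), hA1]
  have he0 : ∀ γ β, primeCode β < primeCode γ → e γ β = 0 := by
    intro γ β hlt
    by_cases h1 : γ - σ γ ≤ β
    · simp only [e, shiftCoeff, if_pos h1]
      refine hA0 _ _ ?_
      rw [← tsub_add_cancel_of_le h1, ← hadd γ, primeCode_add, primeCode_add] at hlt
      rw [hadd γ] at hlt
      exact lt_of_mul_lt_mul_right hlt (Nat.zero_le _)
    · simp only [e, shiftCoeff, if_neg h1]
  have hes : ∀ γ, HasSum (fun β => ‖e γ β‖ * wt t β)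
      ((∑' δ, ‖A γ δ‖ * wt t δ) * wt t (γ - σ γ)) := by
    intro γ
    refine (hasSum_shiftCoeff_iff (g := fun β x => ‖x‖ * wt t β) (by simp)).2 ?_
    simp only [wt_add, ← mul_assoc]
    exact (hA γ).hasSum.mul_right _
  have hele : ∀ γ, ∑' β, ‖e γ β‖ * wt t β ≤ 3 / 2 * wt t γ := by
    intro γ
    rw [(hes γ).tsum_eq]
    refine (mul_le_mul_of_nonneg_right (hA2 γ) (wt_pos _ _).le).trans_eq ?_
    rw [mul_assoc, ← wt_add, hadd]
  let K : (Fin n → ℕ) → (Fin n → ℕ) → ℂ := fun γ β => e γ β - if β = γ then 1 else 0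
  have hKn : ∀ γ β, ‖K γ β‖ * wt t β = ‖e γ β‖ * wt t β - if β = γ then wt t γ else 0 := by
    intro γ β
    by_cases hb : β = γ
    · subst hb
      simp [K, he1]
    · simp [K, hb]
  have hKs : ∀ γ, HasSum (fun β => ‖K γ β‖ * wt t β) (∑' β, ‖e γ β‖ * wt t β - wt t γ) := by
    intro γ
    simp only [hKn]
    exact (hes γ).summable.hasSum.sub (hasSum_ite_eq γ _)
  obtain ⟨b, hb, hbh⟩ := exists_summable_triangular_solution (K := K) primeCode_injective
    (fun β => (wt_pos t β).le) (fun γ β hlt => by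
      rcases (not_lt.1 hlt).lt_or_eq with h1 | h1
      · have : β ≠ γ := fun h => by simp [h] at h1
        simp [K, he0 _ _ h1, this]
      · simp [K, primeCode_injective h1, he1]) (fun γ => (hKs γ).summable)
    (fun γ => by rw [(hKs γ).tsum_eq]; linarith [hele γ]) hh
  refine ⟨b, hb, fun z hz => ?_⟩
  have hβ : ∀ β, HasSum (fun γ => b γ * e γ β) (h β) := by
    intro β
    have := (hbh β).add (hasSum_ite_eq β (b β))
    rw [sub_add_cancel] at this
    refine this.congr_fun fun γ => ?_
    by_cases hg : γ = β
    · subst hg; simp [K, he1]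
    · simp [K, hg, Ne.symm hg, mul_comm]
  have hS : Summable fun p : (Fin n → ℕ) × (Fin n → ℕ) => b p.1 * (e p.1 p.2 * monom z p.2) := by
    refine Summable.of_norm_bounded (g := fun p => ‖b p.1‖ * (‖e p.1 p.2‖ * wt t p.2)) ?_ ?_
    · refine (summable_prod_of_nonneg fun p => ?_).2 ⟨fun γ => ?_, ?_⟩
      · exact mul_nonneg (norm_nonneg _) (mul_nonneg (norm_nonneg _) (wt_pos _ _).le)
      · exact (hes γ).summable.mul_left ‖b γ‖
      · simp only [tsum_mul_left]
        refine Summable.of_nonneg_of_le (fun γ => ?_) (fun γ => ?_) (hb.mul_left (3 / 2))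
        · exact mul_nonneg (norm_nonneg _)
            (tsum_nonneg fun β => mul_nonneg (norm_nonneg _) (wt_pos _ _).le)
        · refine (mul_le_mul_of_nonneg_left (hele γ) (norm_nonneg _)).trans_eq ?_
          ring
    · intro p
      rw [norm_mul, norm_mul]
      gcongr
      exact norm_monom_le hz _
  have hrow : ∀ γ, HasSum (fun β => b γ * (e γ β * monom z β))
      (b γ * (monom z (γ - σ γ) * psum (A γ) z)) := by
    intro γ
    refine HasSum.mul_left _ ?_
    refine (hasSum_shiftCoeff_iff (g := fun β x => x * monom z β) (by simp)).2 ?_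
    rw [mul_comm]
    simp only [monom_add, ← mul_assoc]
    exact ((hA γ).summable hz).hasSum.mul_right _
  have hcol : ∀ β, HasSum (fun γ => b γ * (e γ β * monom z β)) (h β * monom z β) := by
    intro β
    simpa only [mul_assoc] using (hβ β).mul_right (monom z β)
  have h1 := hS.hasSum.prod_fiberwise hrow
  have h2 := ((Equiv.prodComm _ _).hasSum_iff.2 hS.hasSum).prod_fiberwise hcol
  rw [psum, h2.tsum_eq]
  exact h1

/-- `s` is the exponent of smallest code in the support of `a`. -/
def IsLeadingExponent {n : ℕ} (a : (Fin n → ℕ) → ℂ) (s : Fin n → ℕ) : Prop :=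
  a s ≠ 0 ∧ ∀ δ, primeCode δ < primeCode s → a δ = 0

theorem exists_isLeadingExponent {n : ℕ} {a : (Fin n → ℕ) → ℂ} (ha : ∃ γ, a γ ≠ 0) :
    ∃ s, IsLeadingExponent a s := by
  obtain ⟨s, hs, hmin⟩ := (measure (primeCode (n := n))).wf.has_min {γ | a γ ≠ 0} ha
  exact ⟨s, hs, fun δ hδ => by_contra fun h => hmin δ h hδ⟩

theorem exists_forall_tsum_le {n t₀ : ℕ} {a : (Fin n → ℕ) → ℂ} {s : Fin n → ℕ} (hs : a s = 1)
    (hlead : ∀ δ, primeCode δ < primeCode s → a δ = 0) (ha : WSummable t₀ a) :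
    ∃ T, ∀ t ≥ T, WSummable t a ∧ ∑' δ, ‖a δ‖ * wt t δ ≤ 3 / 2 * wt t s := by
  set C := ∑' δ, ‖a δ‖ * wt t₀ δ with hC
  have hC0 : 0 ≤ C := tsum_nonneg fun δ => mul_nonneg (norm_nonneg _) (wt_pos _ _).le
  have hs0 := primeCode_cast_pos s
  set q : ℝ := primeCode s / (primeCode s + 1) with hq
  have hq0 : 0 ≤ q := by positivity
  have hq1 : q < 1 := (div_lt_one (by positivity)).2 (lt_add_one _)
  obtain ⟨k₀, hk₀⟩ : ∃ k₀ : ℕ, q ^ k₀ * C < wt t₀ s / 2 := by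
    have h1 : Tendsto (fun k : ℕ => q ^ k * C) atTop (𝓝 (0 * C)) :=
      (tendsto_pow_atTop_nhds_zero_of_lt_one hq0 hq1).mul_const C
    rw [zero_mul] at h1
    exact (h1.eventually_lt_const (half_pos (wt_pos t₀ s))).exists
  refine ⟨t₀ + k₀, fun t ht => ⟨ha.mono_wt ((Nat.le_add_right _ _).trans ht), ?_⟩⟩
  obtain ⟨k, rfl⟩ := Nat.exists_eq_add_of_le ht
  have hsplit : ∀ δ : Fin n → ℕ,
      wt (t₀ + k₀ + k) δ = wt t₀ δ * ((primeCode δ : ℝ) ^ (k₀ + k))⁻¹ := by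
    intro δ
    rw [wt, wt, add_assoc, pow_add, mul_inv]
  have hterm : ∀ δ, ‖a δ‖ * wt (t₀ + k₀ + k) δ ≤
      (if δ = s then wt (t₀ + k₀ + k) s else 0) +
        (((primeCode s : ℝ) + 1) ^ (k₀ + k))⁻¹ * (‖a δ‖ * wt t₀ δ) := by
    intro δ
    have hnn : 0 ≤ (((primeCode s : ℝ) + 1) ^ (k₀ + k))⁻¹ * (‖a δ‖ * wt t₀ δ) :=
      mul_nonneg (by positivity) (mul_nonneg (norm_nonneg _) (wt_pos _ _).le)
    by_cases hδ : δ = s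
    · subst hδ
      rw [if_pos rfl, hs, norm_one, one_mul]
      exact le_add_of_nonneg_right (by simpa [hs] using hnn)
    · rw [if_neg hδ, zero_add]
      by_cases h0 : a δ = 0
      · simp [h0]
      have h1 : primeCode s < primeCode δ :=
        lt_of_le_of_ne (not_lt.1 fun h => h0 (hlead δ h))
          fun h => hδ (primeCode_injective h).symm
      have h2 : (primeCode s : ℝ) + 1 ≤ primeCode δ := by exact_mod_cast h1
      rw [hsplit, ← mul_assoc, mul_comm]
      refine mul_le_mul_of_nonneg_right ?_ (mul_nonneg (norm_nonneg _) (wt_pos _ _).le)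
      exact inv_anti₀ (by positivity) (pow_le_pow_left₀ (by positivity) h2 _)
  have h3 := (ha.mono_wt ((Nat.le_add_right _ _).trans ht)).tsum_le_tsum hterm
    ((hasSum_ite_eq s _).summable.add (ha.mul_left _))
  rw [((hasSum_ite_eq s _).add (ha.hasSum.mul_left _)).tsum_eq] at h3
  refine h3.trans ?_
  have h4 : (((primeCode s : ℝ) + 1) ^ (k₀ + k))⁻¹ * C ≤ wt (t₀ + k₀ + k) s / 2 := by
    calc (((primeCode s : ℝ) + 1) ^ (k₀ + k))⁻¹ * C
        = ((primeCode s : ℝ) ^ (k₀ + k))⁻¹ * (q ^ (k₀ + k) * C) := by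
          rw [hq, div_pow]
          field_simp
      _ ≤ ((primeCode s : ℝ) ^ (k₀ + k))⁻¹ * (q ^ k₀ * C) := by
          gcongr ?_ * (?_ * _)
          exact pow_le_pow_of_le_one hq0 hq1.le (Nat.le_add_right _ _)
      _ ≤ ((primeCode s : ℝ) ^ (k₀ + k))⁻¹ * (wt t₀ s / 2) := by gcongr
      _ = wt (t₀ + k₀ + k) s / 2 := by
          rw [hsplit]
          ring
  rw [← hC]
  linarith

theorem exists_finset_forall_exists_le {α : Type*} [PartialOrder α] [WellQuasiOrderedLE α]
    (L : Set α) : ∃ S : Finset α, ↑S ⊆ L ∧ ∀ γ ∈ L, ∃ s ∈ S, s ≤ γ := by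
  have hfin : {s | Minimal (· ∈ L) s}.Finite :=
    WellQuasiOrderedLE.finite_of_isAntichain (setOfPred_minimal_antichain _)
  refine ⟨hfin.toFinset, fun s hs => ?_, fun γ hγ => ?_⟩
  · exact (hfin.mem_toFinset.1 hs).prop
  · obtain ⟨s, hs, hmin⟩ := exists_minimal_le_of_wellFoundedLT (· ∈ L) γ hγ
    exact ⟨s, hfin.mem_toFinset.2 hmin, hs⟩

/-- `h` is holomorphic near `0` and vanishes at all but finitely many terms of the sequence `z`. -/
def VanishesAlong {n : ℕ} (z : ℕ → Fin n → ℂ) (h : (Fin n → ℂ) → ℂ) : Prop :=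
  (∃ R > 0, DifferentiableOn ℂ h (ball 0 R)) ∧ ∀ᶠ j in atTop, h (z j) = 0

theorem psum_single_zero {n : ℕ} (x : Fin n → ℂ) : psum (Pi.single 0 1) x = 1 := by
  rw [psum, tsum_eq_single 0 fun β hβ => by simp [hβ]]
  simp [monom]

/-- The germs at `0` of holomorphic functions vanishing along a sequence tending to `0` are
finitely generated, with uniform control on the domain and the boundedness of the coefficients. -/
theorem exists_finite_generators {n : ℕ} {z : ℕ → Fin n → ℂ} (hz : Tendsto z atTop (𝓝 0)) :
    ∃ (S : Finset (Fin n → ℕ)) (g : S → (Fin n → ℂ) → ℂ), (∀ s, VanishesAlong z (g s)) ∧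
      ∀ R > 0, ∃ ρ > 0, ∀ h : (Fin n → ℂ) → ℂ, DifferentiableOn ℂ h (ball 0 R) →
        (∀ᶠ j in atTop, h (z j) = 0) → ∃ (Q : S → (Fin n → ℂ) → ℂ) (C : ℝ),
          ∀ x ∈ ball 0 ρ, h x = ∑ s, Q s x * g s x ∧ ∀ s, ‖Q s x‖ ≤ C := by
  classical
  obtain ⟨S, hSL, hS⟩ := exists_finset_forall_exists_le
    {s : Fin n → ℕ | ∃ a, (∃ t, WSummable t a) ∧ (∀ᶠ j in atTop, psum a (z j) = 0) ∧
      IsLeadingExponent a s}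
  have hex : ∀ s : S, ∃ a : (Fin n → ℕ) → ℂ, (∃ t, WSummable t a) ∧
      (∀ᶠ j in atTop, psum a (z j) = 0) ∧ a s = 1 ∧
      ∀ δ, primeCode δ < primeCode s.1 → a δ = 0 := by
    intro s
    obtain ⟨a, ⟨t, ht⟩, ha, hs0, hlt⟩ := hSL s.2
    refine ⟨fun α => (a s)⁻¹ * a α, ⟨t, ?_⟩, ?_, inv_mul_cancel₀ hs0, fun δ hδ => ?_⟩
    · simp only [WSummable, norm_mul, mul_assoc]
      exact ht.mul_left _
    · filter_upwards [ha] with j hj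
      simp only [psum, mul_assoc, tsum_mul_left] at hj ⊢
      rw [hj, mul_zero]
    · simp only [hlt δ hδ, mul_zero]
  choose a hasum haz ha1 ha0 using hex
  have hT : ∀ s : S, ∃ T, ∀ t ≥ T, WSummable t (a s) ∧
      ∑' δ, ‖a s δ‖ * wt t δ ≤ 3 / 2 * wt t s.1 := fun s => by
    obtain ⟨t, ht⟩ := hasum s
    exact exists_forall_tsum_le (ha1 s) (ha0 s) ht
  choose T hT using hT
  refine ⟨S, fun s => psum (a s), fun s => ⟨?_, haz s⟩, fun R hR => ?_⟩
  · exact ⟨_, half_pos (wtRadius_pos n (T s)), (hT s _ le_rfl).1.differentiableOn⟩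
  obtain ⟨t₀, ht₀⟩ := exists_wSummable_of_differentiableOn n hR
  set t := max t₀ (Finset.univ.sup T) with ht
  have htT : ∀ s, T s ≤ t := fun s =>
    (Finset.le_sup (Finset.mem_univ s)).trans (le_max_right _ _)
  refine ⟨min (wtRadius n t) (R / 2), lt_min (wtRadius_pos n t) (half_pos hR),
    fun h hh hhz => ?_⟩
  obtain ⟨η, hη⟩ := ht₀ h hh
  obtain ⟨hηs, hηh⟩ := hη t (le_max_left _ _)
  obtain ⟨c, hc1, hc2⟩ : ∃ c : (Fin n → ℕ) → Option S, (∀ γ s, c γ = some s → s.1 ≤ γ) ∧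
      ∀ γ, c γ = none → ∀ s ∈ S, ¬ s ≤ γ := by
    refine ⟨fun γ => if h : ∃ s : S, s.1 ≤ γ then some h.choose else none, fun γ s hs => ?_,
      fun γ hγ s hs hle => ?_⟩
    · beta_reduce at hs
      by_cases h1 : ∃ s : S, s.1 ≤ γ
      · rw [dif_pos h1, Option.some_inj] at hs
        exact hs ▸ h1.choose_spec
      · rw [dif_neg h1] at hs
        exact absurd hs (by simp)
    · simp only [dif_pos (⟨⟨s, hs⟩, hle⟩ : ∃ s : S, s.1 ≤ γ)] at hγ
      exact absurd hγ (by simp)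
  let σ : (Fin n → ℕ) → Fin n → ℕ := fun γ => (c γ).elim 0 (fun s => s.1)
  let A : (Fin n → ℕ) → (Fin n → ℕ) → ℂ := fun γ => (c γ).elim (Pi.single 0 1) a
  have hsingle : HasSum (fun δ : Fin n → ℕ =>
      ‖(Pi.single 0 1 : (Fin n → ℕ) → ℂ) δ‖ * wt t δ) (wt t (0 : Fin n → ℕ)) := by
    convert hasSum_ite_eq (0 : Fin n → ℕ) (wt t (0 : Fin n → ℕ)) using 2 with δ
    by_cases hδ : δ = 0
    · subst hδ; simp
    · simp [hδ]
  obtain ⟨b, hb, hbsum⟩ := exists_division (t := t) (σ := σ) (A := A)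
    (fun γ => by
      rcases hcγ : c γ with _ | s
      · simp [σ, hcγ]
      · simpa [σ, hcγ] using hc1 γ s hcγ)
    (fun γ => by
      rcases hcγ : c γ with _ | s
      · simp [σ, A, hcγ]
      · simpa [σ, A, hcγ] using ha1 s)
    (fun γ δ hlt => by
      rcases hcγ : c γ with _ | s
      · have : δ ≠ 0 := fun h => by simp [h, σ, hcγ] at hlt
        simp [A, hcγ, this]
      · simp only [σ, hcγ, Option.elim] at hlt
        simpa [A, hcγ] using ha0 s δ hlt)
    (fun γ => by
      rcases hcγ : c γ with _ | s
      · simp only [A, hcγ, Option.elim]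
        exact hsingle.summable
      · simpa only [A, hcγ, Option.elim] using (hT s t (htT s)).1)
    (fun γ => by
      rcases hcγ : c γ with _ | s
      · simp only [A, σ, hcγ, Option.elim]
        rw [hsingle.tsum_eq]
        linarith [wt_pos t (0 : Fin n → ℕ)]
      · simpa only [A, σ, hcγ, Option.elim] using (hT s t (htT s)).2) hηs
  have hnear : ∀ᶠ j in atTop, z j ∈ ball 0 (min (wtRadius n t) (R / 2)) :=
    hz (ball_mem_nhds _ (lt_min (wtRadius_pos n t) (half_pos hR)))
  have hball : ∀ x ∈ ball (0 : Fin n → ℂ) (min (wtRadius n t) (R / 2)),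
      ‖x‖ ≤ wtRadius n t ∧ x ∈ ball 0 (R / 2) := fun x hx => by
    rw [mem_ball_zero_iff, lt_min_iff] at hx
    exact ⟨hx.1.le, mem_ball_zero_iff.2 hx.2⟩
  have hb0 : ∀ γ, c γ = none → b γ = 0 := by
    let b' : (Fin n → ℕ) → ℂ := fun γ => if c γ = none then b γ else 0
    have hb's : WSummable t b' := by
      refine Summable.of_nonneg_of_le (fun _ => mul_nonneg (norm_nonneg _) (wt_pos _ _).le)
        (fun γ => mul_le_mul_of_nonneg_right ?_ (wt_pos _ _).le) hb
      simp only [b']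
      split_ifs
      · exact le_rfl
      · simp
    have hb'z : ∀ᶠ j in atTop, psum b' (z j) = 0 := by
      filter_upwards [hnear, hhz, eventually_all.2 haz] with j hj hhj hgj
      obtain ⟨h1, h2⟩ := hball _ hj
      have h3 := hbsum _ h1
      rw [← hηh _ h1 h2, hhj] at h3
      rw [psum, ← h3.tsum_eq]
      refine tsum_congr fun γ => ?_
      rcases hcγ : c γ with _ | s
      · simp [b', A, σ, hcγ, psum_single_zero]
      · simp [b', A, σ, hcγ, hgj s]
    intro γ hγ
    by_contra hne
    obtain ⟨s₀, hs₀⟩ := exists_isLeadingExponent (a := b') ⟨γ, by simpa [b', hγ] using hne⟩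
    obtain ⟨s, hs, hle⟩ := hS s₀ ⟨b', ⟨t, hb's⟩, hb'z, hs₀⟩
    refine hc2 s₀ (by_contra fun h => hs₀.1 ?_) s hs hle
    simp [b', h]
  let q : S → (Fin n → ℂ) → (Fin n → ℕ) → ℂ := fun s x γ =>
    if c γ = some s then b γ * monom x (γ - s.1) else 0
  have hq : ∀ s : S, ∀ x ∈ ball (0 : Fin n → ℂ) (min (wtRadius n t) (R / 2)), ∀ γ,
      ‖q s x γ‖ ≤ (wt t s.1)⁻¹ * (‖b γ‖ * wt t γ) := by
    intro s x hx γ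
    simp only [q]
    split_ifs with hcs
    · rw [norm_mul, ← wt_sub_mul t (hc1 γ s hcs)]
      have h1 := (wt_pos t s.1).ne'
      have h2 := norm_monom_le (hball x hx).1 (γ - s.1)
      calc ‖b γ‖ * ‖monom x (γ - s.1)‖ ≤ ‖b γ‖ * wt t (γ - s.1) := by gcongr
        _ = _ := by field_simp
    · have := (wt_pos t s.1).le
      have := (wt_pos t γ).le
      rw [norm_zero]
      positivity
  refine ⟨fun s x => ∑' γ, q s x γ, ∑ s : S, (wt t s.1)⁻¹ * ∑' γ, ‖b γ‖ * wt t γ,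
    fun x hx => ⟨?_, fun s => ?_⟩⟩
  · obtain ⟨h1, h2⟩ := hball x hx
    rw [hηh x h1 h2]
    have h3 : HasSum (fun γ => ∑ s, q s x γ * psum (a s) x)
        (∑ s, (∑' γ, q s x γ) * psum (a s) x) :=
      hasSum_sum fun s _ =>
        ((Summable.of_norm_bounded (hb.mul_left _) (hq s x hx)).hasSum).mul_right _
    refine (hbsum x h1).unique (h3.congr_fun fun γ => ?_)
    rcases hcγ : c γ with _ | s
    · simp [q, hcγ, hb0 γ hcγ]
    · rw [Finset.sum_eq_single s]
      · simp [q, hcγ, A, σ, mul_assoc]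
      · intro s' _ hs'
        simp [q, hcγ, Ne.symm hs']
      · simp
  · refine (tsum_of_norm_bounded (hb.hasSum.mul_left _) (hq s x hx)).trans ?_
    refine Finset.single_le_sum (f := fun s : S => (wt t s.1)⁻¹ * ∑' γ, ‖b γ‖ * wt t γ)
      (fun s _ => ?_) (Finset.mem_univ s)
    exact mul_nonneg (inv_nonneg.2 (wt_pos _ _).le)
      (tsum_nonneg fun _ => mul_nonneg (norm_nonneg _) (wt_pos _ _).le)

theorem differentiableOn_det {E ι : Type*} [NormedAddCommGroup E] [NormedSpace ℂ E] [Fintype ι]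
    [DecidableEq ι] {M : E → Matrix ι ι ℂ} {U : Set E}
    (hM : ∀ i j, DifferentiableOn ℂ (fun x => M x i j) U) :
    DifferentiableOn ℂ (fun x => (M x).det) U := by
  simp only [Matrix.det_apply]
  refine DifferentiableOn.fun_sum fun σ _ => DifferentiableOn.const_smul ?_ _
  exact fun x hx => (HasFDerivWithinAt.finsetProd fun i _ =>
    (hM (σ i) i x hx).hasFDerivWithinAt).differentiableWithinAt

/-- The minor of the Jacobian matrix of `h` on the coordinates `I`. -/
def jacMinor {n r : ℕ} (I : Fin r → Fin n) (h : Fin r → (Fin n → ℂ) → ℂ) (x : Fin n → ℂ) : ℂ :=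
  (Matrix.of fun a b => fderiv ℂ (h b) x (Pi.single (I a) 1)).det

theorem differentiableOn_jacMinor {n r : ℕ} {U : Set (Fin n → ℂ)} (hU : IsOpen U)
    (I : Fin r → Fin n) {h : Fin r → (Fin n → ℂ) → ℂ} (hh : ∀ b, DifferentiableOn ℂ (h b) U) :
    DifferentiableOn ℂ (jacMinor I h) U :=
  differentiableOn_det fun a b => differentiableOn_fderiv_apply hU (hh b) (Pi.single (I a) 1)

/-- The vector field whose derivation of `u` is the Jacobian minor of `u` and `h` on the
coordinates `i₀` and `I`. -/
def jacField {n r : ℕ} (i₀ : Fin n) (I : Fin r → Fin n) (h : Fin r → (Fin n → ℂ) → ℂ)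
    (x : Fin n → ℂ) : Fin n → ℂ :=
  ∑ i : Fin (r + 1), ((-1) ^ (i : ℕ) *
    jacMinor ((Fin.cons i₀ I : Fin (r + 1) → Fin n) ∘ i.succAbove) h x) •
      Pi.single ((Fin.cons i₀ I : Fin (r + 1) → Fin n) i) 1

theorem jacMinor_cons {n r : ℕ} (i₀ : Fin n) (I : Fin r → Fin n) (u : (Fin n → ℂ) → ℂ)
    (h : Fin r → (Fin n → ℂ) → ℂ) (x : Fin n → ℂ) :
    jacMinor (Fin.cons i₀ I : Fin (r + 1) → Fin n)
      (Fin.cons u h : Fin (r + 1) → (Fin n → ℂ) → ℂ) x = fderiv ℂ u x (jacField i₀ I h x) := by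
  rw [jacMinor, Matrix.det_succ_column_zero, jacField, map_sum]
  refine Finset.sum_congr rfl fun i _ => ?_
  rw [map_smul, smul_eq_mul, jacMinor]
  simp only [Matrix.of_apply, Fin.cons_zero]
  rw [mul_right_comm]
  rfl

theorem jacField_apply_of_notMem_range {n r : ℕ} {i₀ : Fin n} {I : Fin r → Fin n}
    (hi₀ : i₀ ∉ range I) (h : Fin r → (Fin n → ℂ) → ℂ) (x : Fin n → ℂ) :
    jacField i₀ I h x i₀ = jacMinor I h x := by
  have hne : ∀ a, i₀ ≠ I a := fun a ha => hi₀ ⟨a, ha.symm⟩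
  rw [jacField, Fin.sum_univ_succ]
  simp only [Pi.add_apply, Finset.sum_apply, Pi.smul_apply, Fin.cons_zero, Fin.cons_succ]
  rw [Finset.sum_eq_zero fun a _ => by simp [Pi.single_eq_of_ne (hne a)]]
  simp only [Fin.val_zero, pow_zero, one_mul, Pi.single_eq_same, smul_eq_mul, mul_one, add_zero]
  rfl

theorem differentiableOn_jacField {n r : ℕ} {U : Set (Fin n → ℂ)} (hU : IsOpen U) (i₀ : Fin n)
    (I : Fin r → Fin n) {h : Fin r → (Fin n → ℂ) → ℂ} (hh : ∀ b, DifferentiableOn ℂ (h b) U) :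
    DifferentiableOn ℂ (jacField i₀ I h) U :=
  DifferentiableOn.fun_sum fun _ _ =>
    ((differentiableOn_jacMinor hU _ hh).const_mul _).smul_const _

theorem contDiffAt_real_of_differentiableOn {n m : ℕ} {U : Set (Fin n → ℂ)} (hU : IsOpen U)
    {V : (Fin n → ℂ) → Fin m → ℂ} (hV : DifferentiableOn ℂ V U) {y : Fin n → ℂ} (hy : y ∈ U) :
    ContDiffAt ℝ 1 V y := by
  refine ContDiffAt.restrict_scalars ℝ (𝕜' := ℂ) (contDiffAt_pi.2 fun i => ?_)
  have hVi : DifferentiableOn ℂ (fun x => V x i) U := fun x hx =>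
    differentiableWithinAt_pi.1 (hV x hx) i
  refine contDiffAt_one_iff.2 ⟨fderiv ℂ fun x => V x i, U, hU.mem_nhds hy, ?_, fun x hx =>
    ((hVi x hx).differentiableAt (hU.mem_nhds hx)).hasFDerivAt⟩
  have hsum : (fderiv ℂ fun x => V x i) = fun x => ∑ k,
      fderiv ℂ (fun x => V x i) x (Pi.single k 1) • ContinuousLinearMap.proj (R := ℂ) k := by
    ext1 x
    refine ContinuousLinearMap.ext fun v => ?_
    rw [clm_apply_eq_sum]
    simp [mul_comm]
  rw [hsum]
  exact continuousOn_finsetSum _ fun k _ =>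
    (differentiableOn_fderiv_apply hU hVi _).continuousOn.smul continuousOn_const

/-- If the derivatives of the `g s` along a vector field are bounded by the `g s`, then the common
zero set of the `g s` contains the integral curves which it meets. -/
theorem frequently_common_zero_of_vectorField {n : ℕ} {S : Type*} [Fintype S]
    {g : S → (Fin n → ℂ) → ℂ} {V : (Fin n → ℂ) → Fin n → ℂ} {y : Fin n → ℂ} {K : ℝ}
    (hV : ContDiffAt ℝ 1 V y) (hVy : V y ≠ 0) (hgy : ∀ s, g s y = 0)
    (hg : ∀ᶠ x in 𝓝 y, ∀ s, DifferentiableAt ℂ (g s) x ∧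
      ‖fderiv ℂ (g s) x (V x)‖ ≤ K * ‖fun s => g s x‖) :
    ∃ᶠ x in 𝓝[≠] y, ∀ s, g s x = 0 := by
  obtain ⟨α, hα0, ε, hε, hα⟩ :=
    hV.exists_forall_mem_closedBall_exists_eq_forall_mem_Ioo_hasDerivAt₀ 0
  have h0 : HasDerivAt α (V y) 0 := hα0 ▸ hα 0 (by constructor <;> linarith)
  have hcont : Tendsto α (𝓝 0) (𝓝 y) := hα0 ▸ h0.continuousAt
  obtain ⟨δ, hδ, hball⟩ := Metric.eventually_nhds_iff.1 (hcont.eventually hg)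
  set η := min (ε / 2) (δ / 2) with hη
  have hη0 : 0 < η := by positivity
  have hηε : η < ε := (min_le_left _ _).trans_lt (half_lt_self hε)
  have hηδ : η < δ := (min_le_right _ _).trans_lt (half_lt_self hδ)
  have hnear : ∀ t ∈ Icc 0 η, HasDerivAt α (V (α t)) t ∧ ∀ s, DifferentiableAt ℂ (g s) (α t) ∧
      ‖fderiv ℂ (g s) (α t) (V (α t))‖ ≤ K * ‖fun s => g s (α t)‖ := fun t ht =>
    ⟨hα t ⟨by linarith [ht.1], by linarith [ht.2]⟩, hball (by
      rw [Real.dist_eq, sub_zero, abs_of_nonneg ht.1]; linarith [ht.2])⟩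
  have hder : ∀ t ∈ Icc 0 η, HasDerivAt (fun t s => g s (α t))
      (fun s => fderiv ℂ (g s) (α t) (V (α t))) t := fun t ht =>
    hasDerivAt_pi.2 fun s =>
      ((((hnear t ht).2 s).1.hasFDerivAt).restrictScalars ℝ).comp_hasDerivAt t (hnear t ht).1
  have hzero : ∀ t ∈ Icc 0 η, (fun s => g s (α t)) = 0 := by
    cases isEmpty_or_nonempty S
    · exact fun t _ => Subsingleton.elim _ _
    · refine eq_zero_of_abs_deriv_le_mul_abs_self_of_eq_zero_right (K := K)
        (f' := fun t s => fderiv ℂ (g s) (α t) (V (α t)))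
        (fun t ht => (hder t ht).continuousAt.continuousWithinAt)
        (fun t ht => (hder t (Ico_subset_Icc_self ht)).hasDerivWithinAt)
        (funext fun s => by simp [hα0, hgy]) fun t ht => ?_
      exact (pi_norm_le_iff_of_nonempty _).2 fun s =>
        ((hnear t (Ico_subset_Icc_self ht)).2 s).2
  have hlim : Tendsto α (𝓝[>] 0) (𝓝[≠] y) :=
    tendsto_nhdsWithin_iff.2 ⟨hcont.mono_left nhdsWithin_le_nhds,
      (h0.eventually_ne hVy).filter_mono (nhdsWithin_mono _ fun t ht => ne_of_gt ht)⟩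
  refine hlim.frequently (Eventually.frequently ?_)
  filter_upwards [Ioo_mem_nhdsGT hη0] with t ht s
  exact congr_fun (hzero t ⟨ht.1.le, ht.2.le⟩) s

theorem VanishesAlong.exists_radius {n : ℕ} {ι : Type*} [Finite ι] {z : ℕ → Fin n → ℂ}
    {h : ι → (Fin n → ℂ) → ℂ} (hh : ∀ i, VanishesAlong z (h i)) :
    ∃ R > 0, ∀ i, DifferentiableOn ℂ (h i) (ball 0 R) := by
  have : ∀ i, ∀ᶠ R in 𝓝[>] (0 : ℝ), DifferentiableOn ℂ (h i) (ball 0 R) := fun i => by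
    obtain ⟨⟨R, hR, hd⟩, -⟩ := hh i
    filter_upwards [Ioo_mem_nhdsGT hR] with r hr
    exact hd.mono (ball_subset_ball hr.2.le)
  obtain ⟨R, hR, h0⟩ := ((eventually_all.2 this).and self_mem_nhdsWithin).exists
  exact ⟨R, h0, hR⟩

/-- There is a Jacobian minor of maximal order, among functions vanishing along `z`, which does
not itself vanish along `z`. -/
theorem exists_maximal_jacMinor {n : ℕ} (z : ℕ → Fin n → ℂ) :
    ∃ (r : ℕ) (I : Fin r → Fin n) (h : Fin r → (Fin n → ℂ) → ℂ),
      (∀ b, VanishesAlong z (h b)) ∧ (∃ᶠ j in atTop, jacMinor I h (z j) ≠ 0) ∧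
      ∀ (I' : Fin (r + 1) → Fin n) (h' : Fin (r + 1) → (Fin n → ℂ) → ℂ),
        (∀ b, VanishesAlong z (h' b)) → ∀ᶠ j in atTop, jacMinor I' h' (z j) = 0 := by
  by_contra! hcon
  have hall : ∀ r : ℕ, ∃ (I : Fin r → Fin n) (h : Fin r → (Fin n → ℂ) → ℂ),
      (∀ b, VanishesAlong z (h b)) ∧ ∃ᶠ j in atTop, jacMinor I h (z j) ≠ 0 := by
    intro r
    induction r with
    | zero => exact ⟨Fin.elim0, Fin.elim0, fun b => b.elim0,
      Frequently.of_forall fun j => by simp [jacMinor]⟩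
    | succ r ih =>
      obtain ⟨I, h, hh, hne⟩ := ih
      obtain ⟨I', h', hh', hne'⟩ := hcon r I h hh hne
      exact ⟨I', h', hh', by simpa using hne'⟩
  obtain ⟨I, h, -, hne⟩ := hall (n + 1)
  obtain ⟨j, hj⟩ := hne.exists
  obtain ⟨a, b, hab, hI⟩ := Fintype.exists_ne_map_eq_of_card_lt I (by simp)
  exact hj (Matrix.det_zero_of_row_eq hab (by ext c; simp [hI]))

/-- Hadamard factors of functions with a nonvanishing Jacobian determinant at `y` provide a
function which vanishes at their common zeros, except at `y`. -/
theorem exists_ne_zero_of_jacMinor_ne_zero {n r : ℕ} {R : ℝ} {I : Fin r → Fin n}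
    (hI : Function.Bijective I) {h : Fin r → (Fin n → ℂ) → ℂ}
    (hh : ∀ b, DifferentiableOn ℂ (h b) (ball 0 R)) {y : Fin n → ℂ} (hy : y ∈ ball 0 R)
    (hhy : ∀ b, h b y = 0) (hne : jacMinor I h y ≠ 0) :
    ∃ d : (Fin n → ℂ) → ℂ, DifferentiableOn ℂ d (ball 0 R) ∧ d y ≠ 0 ∧
      ∀ x ∈ ball 0 R, x ≠ y → (∀ b, h b x = 0) → d x = 0 := by
  choose a ha hay hax using fun b => exists_hadamard_factors (hh b) hy
  refine ⟨fun x => (Matrix.of fun i b => a b (I i) x).det,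
    differentiableOn_det fun i b => ha b (I i), ?_, fun x hx hxy hhx => ?_⟩
  · simpa only [hay, jacMinor] using hne
  · refine Matrix.exists_vecMul_eq_zero_iff.1 ⟨fun i => x (I i) - y (I i), fun h0 => hxy ?_, ?_⟩
    · ext k
      obtain ⟨i, rfl⟩ := hI.2 k
      exact sub_eq_zero.1 (congr_fun h0 i)
    · ext b
      have := hax b x hx
      rw [hhx, hhy, sub_zero, ← hI.sum_comp] at this
      exact this.symm

/-- A convergent sequence of zeros of a holomorphic map contains a non-isolated zero. -/
theorem exists_frequently_zero {n m : ℕ} {z : ℕ → Fin n → ℂ} (hz : Tendsto z atTop (𝓝 0))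
    (hinj : Function.Injective z) {R₀ : ℝ} (hR₀ : 0 < R₀) {G : (Fin n → ℂ) → Fin m → ℂ}
    (hG : DifferentiableOn ℂ G (ball 0 R₀)) (hGz : ∀ j, G (z j) = 0) :
    ∃ j, ∃ᶠ y in 𝓝[≠] z j, G y = 0 := by
  obtain ⟨S, g, hg, hN⟩ := exists_finite_generators hz
  obtain ⟨r, I, h, hh, hne, hmax⟩ := exists_maximal_jacMinor z
  have hGi : ∀ i, VanishesAlong z fun x => G x i := fun i =>
    ⟨⟨R₀, hR₀, fun x hx => differentiableWithinAt_pi.1 (hG x hx) i⟩, by simp [hGz]⟩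
  obtain ⟨R₁, hR₁, hh₁⟩ := VanishesAlong.exists_radius hh
  obtain ⟨R₂, hR₂, hg₂⟩ := VanishesAlong.exists_radius hg
  obtain ⟨R₃, hR₃, hG₃⟩ := VanishesAlong.exists_radius hGi
  obtain ⟨R, hR, hRh, hRg, hRG⟩ : ∃ R > 0, R ≤ R₁ ∧ R ≤ R₂ ∧ R ≤ R₃ :=
    ⟨min R₁ (min R₂ R₃), by positivity, by simp, by simp, by simp⟩
  replace hh₁ := fun b => (hh₁ b).mono (ball_subset_ball hRh)
  replace hg₂ := fun s => (hg₂ s).mono (ball_subset_ball hRg)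
  replace hG₃ := fun i => (hG₃ i).mono (ball_subset_ball hRG)
  obtain ⟨ρ, hρ, hQ⟩ := hN R hR
  have hzball : ∀ t > 0, ∀ᶠ j in atTop, z j ∈ ball 0 t := fun t ht =>
    hz.eventually (ball_mem_nhds 0 ht)
  obtain ⟨j, hj, hjR, hjρ, hhj, hgj⟩ := (hne.and_eventually ((hzball R hR).and ((hzball ρ hρ).and
    ((eventually_all.2 fun b => (hh b).2).and (eventually_all.2 fun s => (hg s).2))))).exists
  refine ⟨j, ?_⟩
  by_cases hsurj : Function.Surjective I
  · exfalso
    have hI : Function.Bijective I := by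
      refine ⟨fun a b hab => by_contra fun hne => hj ?_, hsurj⟩
      exact Matrix.det_zero_of_row_eq hne (by ext c; simp [hab])
    obtain ⟨d, hd, hdj, hd0⟩ := exists_ne_zero_of_jacMinor_ne_zero hI hh₁ hjR hhj hj
    obtain ⟨Q, C, hQC⟩ := hQ d hd (by
      filter_upwards [hzball R hR, eventually_all.2 fun b => (hh b).2, eventually_gt_atTop j]
        with l hl hhl hlj
      exact hd0 _ hl (hinj.ne hlj.ne') hhl)
    exact hdj (by simp [(hQC _ hjρ).1, hgj])
  · obtain ⟨i₀, hi₀⟩ := not_forall.1 hsurj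
    have hV := differentiableOn_jacField isOpen_ball i₀ I hh₁
    have hDg : ∀ s, ∃ (Q : S → (Fin n → ℂ) → ℂ) (C : ℝ), ∀ x ∈ ball 0 ρ,
        fderiv ℂ (g s) x (jacField i₀ I h x) = ∑ s', Q s' x * g s' x ∧ ∀ s', ‖Q s' x‖ ≤ C := by
      intro s
      simp only [← jacMinor_cons]
      refine hQ _ (differentiableOn_jacMinor isOpen_ball _ (Fin.cases (hg₂ s) hh₁))
        (hmax _ _ (Fin.cases (hg s) hh))
    choose Q C hQC using hDg
    choose P E hPE using fun i => hQ _ (hG₃ i) (hGi i).2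
    have hball : ∀ᶠ x in 𝓝 (z j), x ∈ ball (0 : Fin n → ℂ) R ∧ x ∈ ball (0 : Fin n → ℂ) ρ :=
      (isOpen_ball.eventually_mem hjR).and (isOpen_ball.eventually_mem hjρ)
    refine ((frequently_common_zero_of_vectorField (K := ∑ s, Fintype.card S * |C s|)
      (contDiffAt_real_of_differentiableOn isOpen_ball hV hjR) (fun h0 => hj ?_) hgj
      ?_).and_eventually (hball.filter_mono nhdsWithin_le_nhds)).mono ?_
    · rw [← jacField_apply_of_notMem_range hi₀, h0, Pi.zero_apply]
    · filter_upwards [hball] with x hx s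
      refine ⟨(hg₂ s x hx.1).differentiableAt (isOpen_ball.mem_nhds hx.1), ?_⟩
      rw [(hQC s x hx.2).1]
      calc ‖∑ s', Q s s' x * g s' x‖ ≤ ∑ s' : S, |C s| * ‖fun s => g s x‖ := by
            refine norm_sum_le_of_le _ fun s' _ => ?_
            rw [norm_mul]
            exact mul_le_mul (((hQC s x hx.2).2 s').trans (le_abs_self _))
              (norm_le_pi_norm (fun s => g s x) s') (norm_nonneg _) (abs_nonneg _)
        _ = Fintype.card S * |C s| * ‖fun s => g s x‖ := by simp [mul_assoc]
        _ ≤ (∑ s, Fintype.card S * |C s|) * ‖fun s => g s x‖ := by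
            gcongr
            exact Finset.single_le_sum (f := fun s => (Fintype.card S : ℝ) * |C s|)
              (fun s _ => by positivity) (Finset.mem_univ s)
    · rintro x ⟨hx0, -, hx⟩
      ext i
      simp [(hPE i x hx).1, hx0]

end

theorem fixed_points_finite_of_selfmap_extension {n : ℕ} (D : Set (CSpace n))
    (hDopen : IsOpen D) (hDconn : IsConnected D) (hDbdd : Bornology.IsBounded D)
    (f : CSpace n → CSpace n) (hf : DifferentiableOn ℂ f D) (hmaps : Set.MapsTo f D D)
    (hext : ExtendsHolo D f) (hdisc : DiscreteIn (FixOn D f)) :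
    (FixOn D f).Finite := by
  by_contra hinf
  obtain ⟨U, hU, hDU, F, hF, hFf⟩ := hext
  let ψ : ℕ ↪ FixOn D f := Set.Infinite.natEmbedding _ hinf
  let x : ℕ → CSpace n := fun k => ψ k
  have hx : ∀ k, x k ∈ FixOn D f := fun k => (ψ k).2
  have hxinj : Function.Injective x := Subtype.val_injective.comp ψ.injective
  obtain ⟨p, hp, φ, hφ, hlim⟩ := tendsto_subseq_of_bounded hDbdd fun k => (hx k).1
  let e : CSpace n ≃L[ℂ] (Fin n → ℂ) := EuclideanSpace.equiv (Fin n) ℂ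
  let τ : (Fin n → ℂ) → CSpace n := fun v => p + e.symm v
  have hτ : Continuous τ := continuous_const.add e.symm.continuous
  have hτd : Differentiable ℂ τ := e.symm.differentiable.const_add p
  have hτinj : Function.Injective τ := (add_right_injective p).comp e.symm.injective
  have hτ0 : τ 0 = p := by simp [τ]
  let z : ℕ → Fin n → ℂ := fun k => e (x (φ k) - p)
  have hτz : ∀ k, τ (z k) = x (φ k) := fun k => by simp [τ, z]
  obtain ⟨r, hr, hrU⟩ := Metric.mem_nhds_iff.1
    (hτ.continuousAt.preimage_mem_nhds (hU.mem_nhds (hτ0.symm ▸ hDU hp : τ 0 ∈ U)))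
  have hz : Tendsto z atTop (𝓝 0) := by
    have := (e.continuous.tendsto (p - p)).comp (hlim.sub_const p)
    rwa [sub_self, map_zero] at this
  have hzinj : Function.Injective z := fun k l hkl =>
    hφ.injective (hxinj (by rw [← hτz, ← hτz, hkl]))
  obtain ⟨j, hj⟩ := exists_frequently_zero hz hzinj hr (G := fun v => e (F (τ v) - τ v))
    (e.differentiable.comp_differentiableOn
      ((hF.comp hτd.differentiableOn hrU).sub hτd.differentiableOn))
    (fun k => by simp only [hτz, hFf (hx (φ k)).1, (hx (φ k)).2, sub_self, map_zero])
  obtain ⟨ε, hε, hiso⟩ := hdisc _ (hx (φ j))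
  have hnear : ∀ᶠ v in 𝓝[≠] z j, τ v ∈ D ∩ ball (x (φ j)) ε :=
    (hτ.continuousAt.eventually_mem ((hτz j).symm ▸
      (hDopen.inter isOpen_ball).mem_nhds ⟨(hx (φ j)).1, mem_ball_self hε⟩)).filter_mono
      nhdsWithin_le_nhds
  obtain ⟨v, hv, ⟨hvD, hvε⟩, hvne⟩ := (hj.and_eventually (hnear.and self_mem_nhdsWithin)).exists
  have hfix : f (τ v) = τ v := by
    rw [← hFf hvD]
    exact sub_eq_zero.1 (e.map_eq_zero_iff.1 hv)
  exact (hiso _ ⟨hvD, hfix⟩ fun h => hvne (hτinj (h.trans (hτz j).symm))).not_gt hvε
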